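/- arXiv:2506.11323 — 5 statements merged into one kernel-verified Lean document; each statement's English description precedes it below -/
import Mathlib

section
/- The 4-linear map R : W × W × W × W → ℝ defined by R(ξ₁, ξ₂, ξ₃, ξ₄) = −trace([A(ξ₁), A(ξ₂)] ∘ [A(ξ₃), A(ξ₄)]) satisfies the algebraic identities of a curvature tensor: for all ξ₁, ξ₂, ξ₃, ξ₄ ∈ W, (i) R(ξ₁, ξ₂, ξ₃, ξ₄) = −R(ξ₂, ξ₁, ξ₃, ξ₄); (ii) R(ξ₁, ξ₂, ξ₃, ξ₄) = −R(ξ₁, ξ₂, ξ₄, ξ₃); (iii) R(ξ₁, ξ₂, ξ₃, ξ₄) = R(ξ₃, ξ₄, ξ₁, ξ₂); and (iv) the first Bianchi identity R(ξ₁, ξ₂, ξ₃, ξ₄) + R(ξ₂, ξ₃, ξ₁, ξ₄) + R(ξ₃, ξ₁, ξ₂, ξ₄) = 0. (This is the statement that the adapted normal curvature tensor 𝓡, defined from the shape operators of a submanifold by ⟨𝓡_{ξ₁,ξ₂}ξ₃, ξ₄⟩ = −trace([A_{ξ₁}, A_{ξ₂}] ∘ [A_{ξ₃}, A_{ξ₄}]),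 satisfies the identities of a pseudo-Riemannian curvature tensor on the normal space.) -/
/-- Associativity of the trace form with respect to the commutator. -/
theorem trace_mul_commutator {K V : Type*} [CommRing K] [AddCommGroup V] [Module K V]
    (S T U : Module.End K V) :
    LinearMap.trace K V (S * (T * U - U * T)) = LinearMap.trace K V ((S * T - T * S) * U) := by
  have h : LinearMap.trace K V (S * U * T) = LinearMap.trace K V (T * S * U) := by
    rw [LinearMap.trace_mul_comm, mul_assoc]
  simp only [mul_sub, sub_mul, map_sub, ← mul_assoc, h]

/-- The 4-linear map
`R(ξ₁, ξ₂, ξ₃, ξ₄) = −trace([A(ξ₁), A(ξ₂)] ∘ [A(ξ₃), A(ξ₄)])`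
satisfies the algebraic identities of a curvature tensor: skew-symmetry in the first two
and in the last two arguments, symmetry under exchange of the two pairs, and the first
Bianchi identity. -/
theorem stmt_4 (V : Type*) [AddCommGroup V] [Module ℝ V] [FiniteDimensional ℝ V]
    (W : Type*) [AddCommGroup W] [Module ℝ W]
    (A : W →ₗ[ℝ] Module.End ℝ V)
    (R : W → W → W → W → ℝ)
    (hR : ∀ ξ₁ ξ₂ ξ₃ ξ₄, R ξ₁ ξ₂ ξ₃ ξ₄ =
      - LinearMap.trace ℝ V ((A ξ₁ * A ξ₂ - A ξ₂ * A ξ₁) * (A ξ₃ * A ξ₄ - A ξ₄ * A ξ₃)))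
    (ξ₁ ξ₂ ξ₃ ξ₄ : W) :
    R ξ₁ ξ₂ ξ₃ ξ₄ = - R ξ₂ ξ₁ ξ₃ ξ₄ ∧
    R ξ₁ ξ₂ ξ₃ ξ₄ = - R ξ₁ ξ₂ ξ₄ ξ₃ ∧
    R ξ₁ ξ₂ ξ₃ ξ₄ = R ξ₃ ξ₄ ξ₁ ξ₂ ∧
    R ξ₁ ξ₂ ξ₃ ξ₄ + R ξ₂ ξ₃ ξ₁ ξ₄ + R ξ₃ ξ₁ ξ₂ ξ₄ = 0 := by
  simp only [hR]
  refine ⟨?_, ?_, ?_, ?_⟩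
  · rw [← neg_sub, neg_mul, map_neg]
  · rw [← neg_sub (A ξ₄ * A ξ₃), mul_neg, map_neg]
  · rw [LinearMap.trace_mul_comm]
  · simp only [trace_mul_commutator]
    rw [← neg_add, ← neg_add, ← map_add, ← map_add, neg_eq_zero]
    convert map_zero (LinearMap.trace ℝ V)
    noncomm_ring
end

section
/- trace([A₁, A₂] ∘ [A₁, A₂]) ≤ 0, and equality holds if and only if [A₁, A₂] = 0. (Equivalently, the adapted normal curvature tensor of an essentially Riemannian submanifold has non-positive sectional curvatures, with ⟨𝓡_{ξ₁,ξ₂}ξ₂, ξ₁⟩ = 0 if and only if the shape operators A_{ξ₁} and A_{ξ₂} commute.) -/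
/-- The trace of the square of a skew-adjoint endomorphism, as a sum over an orthonormal basis. -/
theorem LinearMap.trace_sq_eq_neg_sum_norm_sq_of_skew {ι W : Type*} [Fintype ι]
    [NormedAddCommGroup W] [InnerProductSpace ℝ W] (b : OrthonormalBasis ι ℝ W)
    (S : Module.End ℝ W) (hS : ∀ x y, inner ℝ (S x) y = -inner ℝ x (S y)) :
    LinearMap.trace ℝ W (S * S) = -∑ i, ‖S (b i)‖ ^ 2 := by
  rw [LinearMap.trace_eq_sum_inner _ b, ← Finset.sum_neg_distrib]
  refine Finset.sum_congr rfl fun i _ => ?_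
  rw [Module.End.mul_apply, ← real_inner_self_eq_norm_sq, hS, neg_neg]

/-- An endomorphism of a finite-dimensional real vector space that is skew-adjoint for a positive
definite symmetric form squares to an endomorphism of nonpositive trace, and the trace vanishes
only if the endomorphism does. -/
theorem LinearMap.trace_sq_nonpos_and_eq_zero_iff_of_skew {W : Type*} [AddCommGroup W]
    [Module ℝ W] [FiniteDimensional ℝ W] (B : W →ₗ[ℝ] W →ₗ[ℝ] ℝ)
    (hsymm : ∀ u v, B u v = B v u) (hpos : ∀ u, u ≠ 0 → 0 < B u u)
    (S : Module.End ℝ W) (hS : ∀ x y, B (S x) y = -B x (S y)) :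
    LinearMap.trace ℝ W (S * S) ≤ 0 ∧ (LinearMap.trace ℝ W (S * S) = 0 ↔ S = 0) := by
  let core : InnerProductSpace.Core ℝ W :=
    { inner := fun u v => B u v
      conj_inner_symm := fun u v => by simp [hsymm u v]
      re_inner_nonneg := fun u => by
        rcases eq_or_ne u 0 with rfl | h
        · simp
        · simpa using (hpos u h).le
      add_left := fun u v w => by simp
      smul_left := fun u v r => by simp
      definite := fun u h => by
        by_contra hu
        exact (hpos u hu).ne' h }
  let _ : NormedAddCommGroup W := core.toNormedAddCommGroup
  let _ : InnerProductSpace ℝ W := InnerProductSpace.ofCore core.toCore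
  let b := stdOrthonormalBasis ℝ W
  rw [trace_sq_eq_neg_sum_norm_sq_of_skew b S hS]
  refine ⟨neg_nonpos.mpr (Finset.sum_nonneg fun i _ => sq_nonneg _), fun h => ?_, ?_⟩
  · rw [neg_eq_zero, Finset.sum_eq_zero_iff_of_nonneg fun i _ => sq_nonneg _] at h
    exact b.toBasis.ext fun i => by simpa using h i (Finset.mem_univ i)
  · rintro rfl
    simp

/-- In the algebraic situation of the shape operators of an essentially
Riemannian submanifold (`V = D ⊕ E`, `B(D,E) = 0`, `B` positive definite on `D`,
`A₁, A₂` `B`-self-adjoint preserving `D` and `E`, with `[A₁,A₂]` vanishing on `E`),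
one has `trace([A₁,A₂] ∘ [A₁,A₂]) ≤ 0` with equality iff `[A₁,A₂] = 0`. -/
theorem stmt_5 (V : Type*) [AddCommGroup V] [Module ℝ V] [FiniteDimensional ℝ V]
    (B : V →ₗ[ℝ] V →ₗ[ℝ] ℝ) (hsymm : ∀ u v, B u v = B v u)
    (D E : Submodule ℝ V) (hcompl : IsCompl D E)
    (horth : ∀ d ∈ D, ∀ e ∈ E, B d e = 0)
    (hpos : ∀ d ∈ D, d ≠ 0 → 0 < B d d)
    (A₁ A₂ : Module.End ℝ V)
    (hsa₁ : ∀ u v, B (A₁ u) v = B u (A₁ v))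
    (hsa₂ : ∀ u v, B (A₂ u) v = B u (A₂ v))
    (hD₁ : ∀ d ∈ D, A₁ d ∈ D) (hD₂ : ∀ d ∈ D, A₂ d ∈ D)
    (hE₁ : ∀ e ∈ E, A₁ e ∈ E) (hE₂ : ∀ e ∈ E, A₂ e ∈ E)
    (hcommE : ∀ e ∈ E, (A₁ * A₂ - A₂ * A₁) e = 0) :
    LinearMap.trace ℝ V ((A₁ * A₂ - A₂ * A₁) * (A₁ * A₂ - A₂ * A₁)) ≤ 0 ∧
    (LinearMap.trace ℝ V ((A₁ * A₂ - A₂ * A₁) * (A₁ * A₂ - A₂ * A₁)) = 0 ↔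
      A₁ * A₂ - A₂ * A₁ = 0) := by
  set C := A₁ * A₂ - A₂ * A₁ with hC
  have hCD : ∀ d ∈ D, C d ∈ D := fun d hd =>
    D.sub_mem (hD₁ _ (hD₂ d hd)) (hD₂ _ (hD₁ d hd))
  have hskew : ∀ u v, B (C u) v = -B u (C v) := fun u v => by
    simp [hC, hsa₁, hsa₂]
  have hdecomp : ∀ v, ∃ d ∈ D, C v = C d := fun v => by
    obtain ⟨d, hd, e, he, rfl⟩ :=
      Submodule.mem_sup.mp (hcompl.sup_eq_top ▸ Submodule.mem_top : v ∈ D ⊔ E)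
    exact ⟨d, hd, by rw [map_add, hcommE e he, add_zero]⟩
  have hrange : ∀ v, C v ∈ D := fun v => by
    obtain ⟨d, hd, h⟩ := hdecomp v
    exact h ▸ hCD d hd
  have htrace : LinearMap.trace ℝ V (C * C) =
      LinearMap.trace ℝ D (C.restrict hCD * C.restrict hCD) :=
    (LinearMap.trace_restrict_eq_of_forall_mem D (C * C) fun v => hrange (C v)).symm
  have hzero : C.restrict hCD = 0 ↔ C = 0 := by
    refine ⟨fun h => LinearMap.ext fun v => ?_, fun h => ?_⟩
    · obtain ⟨d, hd, hv⟩ := hdecomp v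
      simpa [hv] using congrArg Subtype.val (LinearMap.congr_fun h ⟨d, hd⟩)
    · ext x
      simp [h]
  rw [htrace, ← hzero]
  exact LinearMap.trace_sq_nonpos_and_eq_zero_iff_of_skew (B.domRestrict₁₂ D D)
    (fun u v => hsymm u v) (fun u hu => hpos u u.2 (by simpa using hu)) _
    (fun x y => hskew x y)
end

section
/- The horosphere embedding f is differentiable at every x ∈ V, with derivative the linear map u ↦ (B(x,u), B(x,u), u), and this derivative is a linear isometry of bilinear forms: B'((B(x,u), B(x,u), u), (B(x,u'), B(x,u'), u')) = B(u, u') for all u, u' ∈ V. Hence f is an isometric immersion of the pseudo-Euclidean space (V, B) into (ℝ × ℝ × V, B'). -/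
/-- In finite dimension, half the quadratic form of a symmetric bilinear form `B` has derivative
`B x` at `x`. -/
theorem LinearMap.hasFDerivAt_apply_self_div_two {V : Type*} [NormedAddCommGroup V]
    [NormedSpace ℝ V] [FiniteDimensional ℝ V] (B : V →ₗ[ℝ] V →ₗ[ℝ] ℝ)
    (hsymm : ∀ u v, B u v = B v u) (x : V) :
    HasFDerivAt (fun y => B y y / 2) (LinearMap.toContinuousLinearMap (B x)) x := by
  have h := (B.toContinuousBilinearMap.hasFDerivAt_of_bilinear
    (hasFDerivAt_id x) (hasFDerivAt_id x)).mul_const (2⁻¹ : ℝ)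
  refine h.congr_fderiv ?_
  ext u
  change 2⁻¹ * (B x u + B u x) = B x u
  rw [hsymm u x]
  ring

/-- The horosphere embedding `f` is differentiable at every `x`, with
derivative `u ↦ (B(x,u), B(x,u), u)`, and this derivative is a linear isometry of the
bilinear forms: `B'(df_x(u), df_x(u')) = B(u, u')`. Hence `f` is an isometric immersion
of `(V, B)` into `(ℝ × ℝ × V, B')`. -/
theorem stmt_9 (V : Type*) [NormedAddCommGroup V] [NormedSpace ℝ V] [FiniteDimensional ℝ V]
    (B : V →ₗ[ℝ] V →ₗ[ℝ] ℝ) (hsymm : ∀ u v, B u v = B v u)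
    (B' : (ℝ × ℝ × V) → (ℝ × ℝ × V) → ℝ)
    (hB' : ∀ p q, B' p q = -(p.1 * q.1) + p.2.1 * q.2.1 + B p.2.2 q.2.2)
    (f : V → ℝ × ℝ × V)
    (hf : ∀ x, f x = (B x x / 2 + 1, B x x / 2, x))
    (x : V) :
    HasFDerivAt f
      (LinearMap.toContinuousLinearMap ((B x).prod ((B x).prod LinearMap.id))) x ∧
    ∀ u u', B' (B x u, B x u, u) (B x u', B x u', u') = B u u' := by
  constructor
  · have h := B.hasFDerivAt_apply_self_div_two hsymm x
    rw [funext hf]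
    exact (h.add_const 1).prodMk (h.prodMk (hasFDerivAt_id x))
  · intro u u'
    rw [hB']
    ring
end

section
/- For every v ∈ V the linear map T_v preserves the bilinear form B', i.e. B'(T_v(u), T_v(u')) = B'(u, u') for all u, u' ∈ ℝ × ℝ × V; moreover v ↦ T_v is a group homomorphism from the additive group of V into the linear B'-isometries of ℝ × ℝ × V: T₀ is the identity and T_{v + v'} = T_v ∘ T_{v'} for all v, v' ∈ V. -/
/-- Each `T_v` preserves the bilinear form `B'`, and `v ↦ T_v` is a group
homomorphism from the additive group of `V` into the linear `B'`-isometries: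
`T₀ = id` and `T_{v+v'} = T_v ∘ T_{v'}`. -/
theorem stmt_12 (V : Type*) [AddCommGroup V] [Module ℝ V]
    (B : V →ₗ[ℝ] V →ₗ[ℝ] ℝ) (hsymm : ∀ u v, B u v = B v u)
    (B' : (ℝ × ℝ × V) → (ℝ × ℝ × V) → ℝ)
    (hB' : ∀ p q, B' p q = -(p.1 * q.1) + p.2.1 * q.2.1 + B p.2.2 q.2.2)
    (T : V → (ℝ × ℝ × V) →ₗ[ℝ] (ℝ × ℝ × V))
    (hT : ∀ v (a b : ℝ) (w : V), T v (a, b, w) =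
      (a + B w v + (a - b) * B v v / 2, b + B w v + (a - b) * B v v / 2, w + (a - b) • v)) :
    (∀ v u u', B' (T v u) (T v u') = B' u u') ∧
    T 0 = LinearMap.id ∧
    ∀ v v', T (v + v') = T v ∘ₗ T v' := by
  refine ⟨?_, ?_, ?_⟩
  · rintro v ⟨a, b, w⟩ ⟨a', b', w'⟩
    simp only [hB', hT, map_add, map_smul, LinearMap.add_apply, LinearMap.smul_apply,
      smul_eq_mul, hsymm v w']
    ring
  · refine LinearMap.ext ?_
    rintro ⟨a, b, w⟩
    simp [hT]
  · intro v v'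
    refine LinearMap.ext ?_
    rintro ⟨a, b, w⟩
    simp only [hT, LinearMap.comp_apply, map_add, map_smul, LinearMap.add_apply,
      LinearMap.smul_apply, smul_eq_mul, hsymm v v', Prod.mk.injEq]
    refine ⟨by ring, by ring, ?_⟩
    module
end

section
/- Assume in addition that B is nondegenerate. For every x ∈ V, the B'-orthogonal complement of the tangent space of the pseudo-horosphere Q = f(V) at f(x) — i.e. the set of all u ∈ ℝ × ℝ × V with B'(u, (B(x,w), B(x,w), w)) = 0 for all w ∈ V — equals the two-dimensional linear span of the lightlike vector ξ⁰ = (1, 1, 0) and the position vector f(x). (Thus the normal bundle of Q is spanned by the two parallel umbilical normal fields ξ⁰ and the position field.) -/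
/-- If `B` is nondegenerate, then for every `x` the `B'`-orthogonal
complement of the tangent space of the pseudo-horosphere `Q = f(V)` at `f(x)` equals the
two-dimensional linear span of the lightlike vector `ξ⁰ = (1,1,0)` and the position
vector `f(x)`. -/
theorem stmt_13 (V : Type*) [AddCommGroup V] [Module ℝ V] [FiniteDimensional ℝ V]
    (B : V →ₗ[ℝ] V →ₗ[ℝ] ℝ) (hsymm : ∀ u v, B u v = B v u)
    (hnd : ∀ u, (∀ v, B u v = 0) → u = 0)
    (B' : (ℝ × ℝ × V) → (ℝ × ℝ × V) → ℝ)
    (hB' : ∀ p q, B' p q = -(p.1 * q.1) + p.2.1 * q.2.1 + B p.2.2 q.2.2)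
    (f : V → ℝ × ℝ × V)
    (hf : ∀ x, f x = (B x x / 2 + 1, B x x / 2, x))
    (x : V) :
    {u : ℝ × ℝ × V | ∀ w : V, B' u (B x w, B x w, w) = 0} =
      (Submodule.span ℝ {((1:ℝ), (1:ℝ), (0:V)), f x} : Set (ℝ × ℝ × V)) ∧
    Module.finrank ℝ (Submodule.span ℝ {((1:ℝ), (1:ℝ), (0:V)), f x}) = 2 := by
  constructor
  · ext ⟨a, b, v⟩
    simp only [Set.mem_ofPred_eq, SetLike.mem_coe, Submodule.mem_span_pair, hB', hf]
    constructor
    · intro h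
      have hv : v = (a - b) • x := by
        refine sub_eq_zero.mp (hnd _ fun w => ?_)
        simp only [map_sub, map_smul, LinearMap.sub_apply, LinearMap.smul_apply, smul_eq_mul]
        linear_combination h w
      refine ⟨b - (a - b) * (B x x / 2), a - b, ?_⟩
      ext
      · simp; ring
      · simp
      · simp [hv]
    · rintro ⟨s, t, h⟩ w
      simp only [Prod.smul_mk, Prod.mk_add_mk, Prod.mk.injEq, smul_eq_mul, smul_zero,
        zero_add] at h
      obtain ⟨rfl, rfl, rfl⟩ := h
      simp only [map_smul, LinearMap.smul_apply, smul_eq_mul]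
      ring
  · have hli : LinearIndependent ℝ ![((1 : ℝ), (1 : ℝ), (0 : V)), f x] := by
      refine LinearIndependent.pair_iff.mpr fun s t h => ?_
      simp only [hf, Prod.smul_mk, Prod.mk_add_mk, Prod.mk_eq_zero, smul_eq_mul] at h
      obtain ⟨h₁, h₂, -⟩ := h
      have ht : t = 0 := by linear_combination h₁ - h₂
      subst ht
      exact ⟨by linear_combination h₁, rfl⟩
    rw [← Matrix.range_cons_cons_empty _ _ ![], finrank_span_eq_card hli, Fintype.card_fin]
end
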